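/- arXiv:1210.2273 — 2 statements merged into one kernel-verified Lean document; each statement's English description precedes it below -/
import Mathlib

section
/- For every probabilistic pushdown automaton Δ = (Q, Γ, Σ, ↪) there exists a nondeterministic pushdown automaton Δ' = (Q, Γ', Σ', ↪') with Γ ⊆ Γ' and Σ ⊆ Σ', such that for all configurations q₁γ₁ and q₂γ₂ of Δ (which are also configurations of Δ'): q₁γ₁ ∼ q₂γ₂ in S(Δ) if and only if q₁γ₁ ∼ q₂γ₂ in S(Δ'). Moreover, if Δ has a single control state (is a pBPA), then Δ' has a single control state (is a BPA). -/
open scoped ENNReal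

noncomputable section

/-- A probabilistic labelled transition system (pLTS): states `S`, alphabet `A`,
and a transition relation into probability distributions (`PMF`s) on `S`. -/
structure PLTS (S : Type) (A : Type) where
  Tr : S → A → PMF S → Prop

namespace PLTS

variable {S A : Type}

/-- The mass that a distribution assigns to a set of states. -/
def mass (d : PMF S) (E : Set S) : ℝ≥0∞ := ∑' s : E, d s

/-- Two distributions are `r`-equivalent if they assign equal mass to every
`r`-equivalence class (for an equivalence `r`, the classes are the sets `{t | r s t}`). -/
def REquiv (r : S → S → Prop) (d d' : PMF S) : Prop :=
  ∀ s : S, mass d {t | r s t} = mass d' {t | r s t}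

/-- An equivalence relation is a bisimulation if related states can match
each other's transitions with `r`-equivalent target distributions. -/
def IsBisimulation (L : PLTS S A) (r : S → S → Prop) : Prop :=
  Equivalence r ∧
    ∀ s t, r s t → ∀ a d, L.Tr s a d → ∃ d', L.Tr t a d' ∧ REquiv r d d'

/-- Bisimilarity: the union of all bisimulation relations. -/
def Bisim (L : PLTS S A) (s t : S) : Prop :=
  ∃ r, L.IsBisimulation r ∧ r s t

/-- The bisimulation approximants `∼ₙ`. -/
def approx (L : PLTS S A) : ℕ → S → S → Prop
  | 0 => fun _ _ => True
  | n + 1 => fun s t =>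
      (∀ a d, L.Tr s a d → ∃ d', L.Tr t a d' ∧ REquiv (L.approx n) d d') ∧
      (∀ a d', L.Tr t a d' → ∃ d, L.Tr s a d ∧ REquiv (L.approx n) d d')

/-- A pLTS is finitely branching if every state has finitely many transitions. -/
def FinBranching (L : PLTS S A) : Prop :=
  ∀ s, {p : A × PMF S | L.Tr s p.1 p.2}.Finite

/-- One-step successor relation: `s → s'` iff some transition of `s` gives `s'`
positive probability. -/
def Step (L : PLTS S A) (s s' : S) : Prop :=
  ∃ a d, L.Tr s a d ∧ d s' ≠ 0

end PLTS

/-- The rules of a probabilistic pushdown automaton (pPDA) with control states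
`Q`, stack alphabet `Γ`, input alphabet `A`: a rule `qX –a↪ d` is a tuple
`(q, X, a, d)` where `d` is a distribution over pairs of a control state and
a string of length at most two that replaces the top symbol. -/
def PPDARules (Q Γ A : Type) := Q → Γ → A → PMF (Q × List Γ) → Prop

/-- Well-formedness of pPDA rules: target distributions are supported on
configurations `(p, α)` with `|α| ≤ 2` (i.e. `α ∈ Γ^{≤2}`). -/
def PPDAWf {Q Γ A : Type} (Δ : PPDARules Q Γ A) : Prop :=
  ∀ q X a d, Δ q X a d → ∀ p (α : List Γ), d (p, α) ≠ 0 → α.length ≤ 2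

/-- A nondeterministic PDA is a pPDA all of whose rules use Dirac distributions. -/
def IsPDA {Q Γ A : Type} (Δ : PPDARules Q Γ A) : Prop :=
  ∀ q X a d, Δ q X a d → ∃ c, d = PMF.pure c

/-- The pLTS induced by a pPDA on configurations `Q × Γ*`: a rule `qX –a↪ d`
and a tail `β ∈ Γ*` induce the transition `qXβ –a→ d'` with `d'(pαβ) = d(pα)`;
configurations with empty stack have no transitions. -/
def PPDARules.plts {Q Γ A : Type} (Δ : PPDARules Q Γ A) : PLTS (Q × List Γ) A where
  Tr := fun c a d' => ∃ (q : Q) (X : Γ) (β : List Γ) (d : PMF (Q × List Γ)),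
    c = (q, X :: β) ∧ Δ q X a d ∧ d' = d.map (fun pα => (pα.1, pα.2 ++ β))

namespace PLTS

variable {S A : Type}

lemma mass_eq_toOuterMeasure (d : PMF S) (E : Set S) : mass d E = d.toOuterMeasure E := by
  rw [mass, PMF.toOuterMeasure_apply, tsum_subtype E (fun s => d s)]

/-- Equivalent distributions agree on all sets that are closed under the equivalence. -/
lemma REquiv.toOuterMeasure_eq {r : S → S → Prop} (hr : Equivalence r) {d d' : PMF S}
    (h : REquiv r d d') {E : Set S} (hE : ∀ s t, r s t → s ∈ E → t ∈ E) :
    d.toOuterMeasure E = d'.toOuterMeasure E := by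
  let R : Setoid S := ⟨r, hr⟩
  have key : ∀ (e : PMF S) (s : S),
      e.map (Quotient.mk R) (Quotient.mk R s) = mass e {t | r s t} := by
    intro e s
    rw [mass_eq_toOuterMeasure, ← PMF.toOuterMeasure_apply_singleton,
      PMF.toOuterMeasure_map_apply]
    congr 1
    ext t
    simp only [Set.mem_preimage, Set.mem_singleton_iff, Set.mem_ofPred_eq]
    exact ⟨fun ht => hr.symm (Quotient.exact ht), fun ht => Quotient.sound (hr.symm ht)⟩
  have hmap : d.map (Quotient.mk R) = d'.map (Quotient.mk R) := by
    ext x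
    induction x using Quotient.inductionOn with
    | h s => rw [key, key, h s]
  have hpre : E = Quotient.mk R ⁻¹' (Quotient.mk R '' E) := by
    ext t
    refine ⟨fun ht => ⟨t, ht, rfl⟩, ?_⟩
    rintro ⟨s, hs, hst⟩
    exact hE s t (Quotient.exact hst) hs
  rw [hpre, ← PMF.toOuterMeasure_map_apply, ← PMF.toOuterMeasure_map_apply, hmap]

lemma REquiv_pure_iff {r : S → S → Prop} (hr : Equivalence r) {s t : S} :
    REquiv r (PMF.pure s) (PMF.pure t) ↔ r s t := by
  classical
  simp only [REquiv, mass_eq_toOuterMeasure, PMF.toOuterMeasure_pure_apply, Set.mem_ofPred_eq]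
  constructor
  · intro h
    by_contra hst
    simpa [hr.refl s, hst] using h s
  · intro h x
    have : r x s ↔ r x t := ⟨fun hx => hr.trans hx h, fun hx => hr.trans hx (hr.symm h)⟩
    simp [this]

/-- In a system whose transitions are all Dirac, a symmetric relation with the usual transfer
property is contained in bisimilarity. -/
lemma bisim_of_transfer {L : PLTS S A} (hL : ∀ s a d, L.Tr s a d → ∃ s', d = PMF.pure s')
    {r : S → S → Prop} (hsymm : ∀ s t, r s t → r t s)
    (h : ∀ s t, r s t → ∀ a s', L.Tr s a (PMF.pure s') →
      ∃ t', L.Tr t a (PMF.pure t') ∧ r s' t') {s t : S} (hst : r s t) : L.Bisim s t := by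
  have main : ∀ s t, Relation.EqvGen r s t →
      (∀ a s', L.Tr s a (PMF.pure s') → ∃ t', L.Tr t a (PMF.pure t') ∧ Relation.EqvGen r s' t') ∧
      (∀ a t', L.Tr t a (PMF.pure t') →
        ∃ s', L.Tr s a (PMF.pure s') ∧ Relation.EqvGen r t' s') := by
    intro s t hst
    induction hst with
    | rel s t hst =>
      refine ⟨fun a s' hs => ?_, fun a t' ht => ?_⟩
      · obtain ⟨t', ht, hr⟩ := h s t hst a s' hs
        exact ⟨t', ht, .rel _ _ hr⟩
      · obtain ⟨s', hs, hr⟩ := h t s (hsymm s t hst) a t' ht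
        exact ⟨s', hs, .rel _ _ hr⟩
    | refl s => exact ⟨fun a s' hs => ⟨s', hs, .refl _⟩, fun a s' hs => ⟨s', hs, .refl _⟩⟩
    | symm s t _ ih => exact ⟨ih.2, ih.1⟩
    | trans s t u _ _ ih₁ ih₂ =>
      refine ⟨fun a s' hs => ?_, fun a u' hu => ?_⟩
      · obtain ⟨t', ht, h₁⟩ := ih₁.1 a s' hs
        obtain ⟨u', hu, h₂⟩ := ih₂.1 a t' ht
        exact ⟨u', hu, h₁.trans _ _ _ h₂⟩
      · obtain ⟨t', ht, h₁⟩ := ih₂.2 a u' hu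
        obtain ⟨s', hs, h₂⟩ := ih₁.2 a t' ht
        exact ⟨s', hs, h₁.trans _ _ _ h₂⟩
  have heq : Equivalence (Relation.EqvGen r) := Relation.EqvGen.is_equivalence r
  refine ⟨Relation.EqvGen r, ⟨heq, fun s t hst a d hd => ?_⟩, .rel _ _ hst⟩
  obtain ⟨s', rfl⟩ := hL s a d hd
  obtain ⟨t', ht, hr⟩ := (main s t hst).1 a s' hd
  exact ⟨_, ht, (REquiv_pure_iff heq).2 hr⟩

/-- A bisimulation matches Dirac transitions by Dirac transitions to related states, provided all
transitions are Dirac. -/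
lemma IsBisimulation.transfer {L : PLTS S A} (hL : ∀ s a d, L.Tr s a d → ∃ s', d = PMF.pure s')
    {r : S → S → Prop} (hr : L.IsBisimulation r) {s t : S} (hst : r s t) {a : A} {s' : S}
    (hs : L.Tr s a (PMF.pure s')) : ∃ t', L.Tr t a (PMF.pure t') ∧ r s' t' := by
  obtain ⟨d, hd, h⟩ := hr.2 s t hst a _ hs
  obtain ⟨t', rfl⟩ := hL t a d hd
  exact ⟨t', hd, (REquiv_pure_iff hr.1).1 h⟩

end PLTS

namespace PPDARules

variable {Q Γ A W : Type}

/-- The possible right-hand sides of rules. -/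
abbrev Target (Q Γ : Type) : Type := {c : Q × List Γ // c.2.length ≤ 2}

instance [Finite Q] [Finite Γ] : Finite (Target Q Γ) := by
  have h : Finite {l : List Γ // l.length ≤ 2} := List.finite_length_le Γ 2
  exact Finite.of_injective
    (fun c : Target Q Γ => ((c.1.1, ⟨c.1.2, c.2⟩) : Q × {l : List Γ // l.length ≤ 2}))
    (fun c c' h => by
      simp only [Prod.mk.injEq, Subtype.mk.injEq] at h
      exact Subtype.ext (Prod.ext h.1 h.2))

/-- Put `β` below a configuration. -/
def push (β : List Γ) (c : Q × List Γ) : Q × List Γ := (c.1, c.2 ++ β)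

/-- The probability of a set of right-hand sides. -/
def prob (d : PMF (Q × List Γ)) (T : Set (Target Q Γ)) : ℝ≥0∞ :=
  d.toOuterMeasure (Subtype.val '' T)

lemma prob_mono (d : PMF (Q × List Γ)) {T T' : Set (Target Q Γ)} (h : T ⊆ T') :
    prob d T ≤ prob d T' :=
  d.toOuterMeasure.mono (Set.image_mono h)

/-- The right-hand sides with positive probability. -/
def targetSupport (d : PMF (Q × List Γ)) : Set (Target Q Γ) := {u | d u.1 ≠ 0}

lemma prob_inter_targetSupport (d : PMF (Q × List Γ)) (T : Set (Target Q Γ)) :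
    prob d (T ∩ targetSupport d) = prob d T := by
  refine PMF.toOuterMeasure_apply_eq_of_inter_support_eq _ ?_
  ext c
  simp only [targetSupport, Set.mem_inter_iff, Set.mem_image, Set.mem_ofPred_eq, PMF.mem_support_iff]
  constructor
  · rintro ⟨⟨u, ⟨hu, _⟩, rfl⟩, h⟩
    exact ⟨⟨u, hu, rfl⟩, h⟩
  · rintro ⟨⟨u, hu, rfl⟩, h⟩
    exact ⟨⟨u, ⟨hu, h⟩, rfl⟩, h⟩

lemma toOuterMeasure_map_push {d : PMF (Q × List Γ)}
    (hd : ∀ p (α : List Γ), d (p, α) ≠ 0 → α.length ≤ 2) (β : List Γ) (E : Set (Q × List Γ)) :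
    (d.map (push β)).toOuterMeasure E = prob d {u | push β u.1 ∈ E} := by
  rw [PMF.toOuterMeasure_map_apply]
  refine PMF.toOuterMeasure_apply_eq_of_inter_support_eq _ ?_
  ext ⟨p, α⟩
  simp only [Set.mem_inter_iff, Set.mem_preimage, Set.mem_image, Set.mem_ofPred_eq,
    PMF.mem_support_iff]
  constructor
  · rintro ⟨h, h0⟩
    exact ⟨⟨⟨(p, α), hd p α h0⟩, h, rfl⟩, h0⟩
  · rintro ⟨⟨u, hu, heq⟩, h0⟩
    exact ⟨heq ▸ hu, h0⟩

/-- The stack alphabet of the simulating PDA: the old symbols, finite abstractions of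
distributions, and sets of right-hand sides. -/
abbrev StackSym (Q Γ W : Type) : Type := Γ ⊕ (Set (W × Set (Target Q Γ)) ⊕ Set (Target Q Γ))

/-- The abstraction of a distribution with respect to a family of thresholds. -/
def abstraction (th : W → ℝ≥0∞) (d : PMF (Q × List Γ)) : Set (W × Set (Target Q Γ)) :=
  {x | x.2 ⊆ targetSupport d ∧ th x.1 ≤ prob d x.2}

/-- A configuration of the original automaton as one of the simulating PDA. -/
def embed (W : Type) (c : Q × List Γ) : Q × List (StackSym Q Γ W) := (c.1, c.2.map Sum.inl)

/-- The rules of the simulating PDA: choose a distribution, then a set of right-hand sides whose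
probability reaches some threshold, then an element of this set. -/
inductive simulation (Δ : PPDARules Q Γ A) (th : W → ℝ≥0∞) :
    PPDARules Q (StackSym Q Γ W) (A ⊕ Option W)
  | choose (q : Q) (X : Γ) (a : A) (d : PMF (Q × List Γ)) (h : Δ q X a d) :
      simulation Δ th q (Sum.inl X) (Sum.inl a)
        (PMF.pure (q, [Sum.inr (Sum.inl (abstraction th d))]))
  | test (q : Q) (v : Set (W × Set (Target Q Γ))) (w : W) (T : Set (Target Q Γ))
      (h : (w, T) ∈ v) :
      simulation Δ th q (Sum.inr (Sum.inl v)) (Sum.inr (some w))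
        (PMF.pure (q, [Sum.inr (Sum.inr T)]))
  | select (q : Q) (T : Set (Target Q Γ)) (u : Target Q Γ) (h : u ∈ T) :
      simulation Δ th q (Sum.inr (Sum.inr T)) (Sum.inr none) (PMF.pure (embed W u.1))

variable {Δ : PPDARules Q Γ A} {th : W → ℝ≥0∞}

lemma isPDA_simulation : IsPDA (Δ.simulation th) := by
  rintro q X a d (_ | _ | _) <;> exact ⟨_, rfl⟩

lemma pPDAWf_simulation : PPDAWf (Δ.simulation th) := by
  intro q X a d h p α hα
  cases h <;> obtain ⟨-, rfl⟩ := Prod.mk.inj ((PMF.mem_support_pure_iff _ _).1 hα)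
  · simp
  · simp
  · rename_i T u hu
    simpa [embed] using u.2

lemma plts_tr_iff {q : Q} {l : List Γ} {a : A} {e : PMF (Q × List Γ)} :
    Δ.plts.Tr (q, l) a e ↔
      ∃ X β d, l = X :: β ∧ Δ q X a d ∧ e = d.map (push β) := by
  constructor
  · rintro ⟨q', X, β, d, h, hd, rfl⟩
    obtain ⟨rfl, rfl⟩ := Prod.mk.inj h
    exact ⟨X, β, d, rfl, hd, rfl⟩
  · rintro ⟨X, β, d, rfl, hd, rfl⟩
    exact ⟨q, X, β, d, rfl, hd, rfl⟩

lemma exists_pure_of_tr_simulation (s) (a) (d) (h : (Δ.simulation th).plts.Tr s a d) :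
    ∃ s', d = PMF.pure s' := by
  obtain ⟨q, X, β, d, -, hd, rfl⟩ := h
  obtain ⟨c, rfl⟩ := isPDA_simulation q X a d hd
  exact ⟨_, PMF.pure_map _ _⟩

lemma pure_injective {S : Type} {s t : S} (h : PMF.pure s = PMF.pure t) : s = t := by
  have : s ∈ (PMF.pure t).support := h ▸ (PMF.mem_support_pure_iff s s).2 rfl
  exact (PMF.mem_support_pure_iff _ _).1 this

lemma embed_push (β : List Γ) (c : Q × List Γ) :
    push (β.map Sum.inl) (embed W c) = embed W (push β c) := by
  simp [push, embed]

lemma tr_embed_iff {q : Q} {l : List Γ} {a : A ⊕ Option W} {s : Q × List (StackSym Q Γ W)} :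
    (Δ.simulation th).plts.Tr (embed W (q, l)) a (PMF.pure s) ↔
      ∃ X β a' d, l = X :: β ∧ a = Sum.inl a' ∧ Δ q X a' d ∧
        s = (q, Sum.inr (Sum.inl (abstraction th d)) :: β.map Sum.inl) := by
  rw [embed, plts_tr_iff]
  constructor
  · rintro ⟨X, β, d, hl, hd, he⟩
    obtain ⟨X, β, rfl, rfl, rfl⟩ := List.map_eq_cons_iff.1 hl
    cases hd
    rename_i a d hd
    rw [PMF.pure_map] at he
    exact ⟨X, β, a, d, rfl, rfl, hd, pure_injective he⟩
  · rintro ⟨X, β, a, d, rfl, rfl, hd, rfl⟩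
    exact ⟨_, _, _, rfl, .choose q X a d hd, by rw [PMF.pure_map]; rfl⟩

lemma tr_abstraction_iff {q : Q} {v : Set (W × Set (Target Q Γ))} {l : List (StackSym Q Γ W)}
    {a : A ⊕ Option W} {s : Q × List (StackSym Q Γ W)} :
    (Δ.simulation th).plts.Tr (q, Sum.inr (Sum.inl v) :: l) a (PMF.pure s) ↔
      ∃ w T, (w, T) ∈ v ∧ a = Sum.inr (some w) ∧ s = (q, Sum.inr (Sum.inr T) :: l) := by
  rw [plts_tr_iff]
  constructor
  · rintro ⟨X, β, d, hl, hd, he⟩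
    obtain ⟨rfl, rfl⟩ := List.cons.inj hl
    cases hd
    rename_i w T h
    rw [PMF.pure_map] at he
    exact ⟨w, T, h, rfl, pure_injective he⟩
  · rintro ⟨w, T, h, rfl, rfl⟩
    exact ⟨_, _, _, rfl, .test q v w T h, by rw [PMF.pure_map]; rfl⟩

lemma tr_set_iff {q : Q} {T : Set (Target Q Γ)} {β : List Γ}
    {a : A ⊕ Option W} {s : Q × List (StackSym Q Γ W)} :
    (Δ.simulation th).plts.Tr (q, Sum.inr (Sum.inr T) :: β.map Sum.inl) a (PMF.pure s) ↔
      ∃ u ∈ T, a = Sum.inr none ∧ s = embed W (push β u.1) := by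
  rw [plts_tr_iff]
  constructor
  · rintro ⟨X, β, d, hl, hd, he⟩
    obtain ⟨rfl, rfl⟩ := List.cons.inj hl
    cases hd
    rename_i u h
    rw [PMF.pure_map, embed_push] at he
    exact ⟨u, h, rfl, pure_injective he⟩
  · rintro ⟨u, h, rfl, rfl⟩
    exact ⟨_, _, _, rfl, .select q T u h, by rw [PMF.pure_map, embed_push]⟩

/-- Two sets of right-hand sides cover the same classes of configurations. -/
def SetMatch (r : Q × List Γ → Q × List Γ → Prop) (β β' : List Γ) (T T' : Set (Target Q Γ)) :
    Prop :=
  (∀ u ∈ T, ∃ u' ∈ T', r (push β u.1) (push β' u'.1)) ∧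
    ∀ u' ∈ T', ∃ u ∈ T, r (push β' u'.1) (push β u.1)

lemma SetMatch.symm {r : Q × List Γ → Q × List Γ → Prop} {β β' : List Γ}
    {T T' : Set (Target Q Γ)} (h : SetMatch r β β' T T') : SetMatch r β' β T' T :=
  ⟨h.2, h.1⟩

/-- The relation on configurations of the simulating PDA that is induced by a relation on
configurations of the original automaton. -/
inductive liftRel (W : Type) (r : Q × List Γ → Q × List Γ → Prop) :
    Q × List (StackSym Q Γ W) → Q × List (StackSym Q Γ W) → Prop
  | config (c c' : Q × List Γ) (h : r c c') : liftRel W r (embed W c) (embed W c')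
  | abstraction (q q' : Q) (v v' : Set (W × Set (Target Q Γ))) (β β' : List Γ)
      (h : ∀ w T, (w, T) ∈ v → ∃ T', (w, T') ∈ v' ∧ SetMatch r β β' T T')
      (h' : ∀ w T', (w, T') ∈ v' → ∃ T, (w, T) ∈ v ∧ SetMatch r β' β T' T) :
      liftRel W r (q, Sum.inr (Sum.inl v) :: β.map Sum.inl)
        (q', Sum.inr (Sum.inl v') :: β'.map Sum.inl)
  | set (q q' : Q) (T T' : Set (Target Q Γ)) (β β' : List Γ) (h : SetMatch r β β' T T') :
      liftRel W r (q, Sum.inr (Sum.inr T) :: β.map Sum.inl)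
        (q', Sum.inr (Sum.inr T') :: β'.map Sum.inl)

lemma liftRel.symm {r : Q × List Γ → Q × List Γ → Prop} (hr : Equivalence r)
    (s t) (h : liftRel W r s t) : liftRel W r t s := by
  cases h with
  | config c c' h => exact .config _ _ (hr.symm h)
  | abstraction q q' v v' β β' h h' => exact .abstraction _ _ _ _ _ _ h' h
  | set q q' T T' β β' h => exact .set _ _ _ _ _ _ h.symm

/-- Abstractions of equivalent distributions match. -/
lemma exists_setMatch {r : Q × List Γ → Q × List Γ → Prop} (hr : Equivalence r) (th : W → ℝ≥0∞)
    {d d' : PMF (Q × List Γ)} (hd : ∀ p (α : List Γ), d (p, α) ≠ 0 → α.length ≤ 2)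
    (hd' : ∀ p (α : List Γ), d' (p, α) ≠ 0 → α.length ≤ 2) {β β' : List Γ}
    (h : PLTS.REquiv r (d.map (push β)) (d'.map (push β'))) (w : W) (T : Set (Target Q Γ))
    (hT : (w, T) ∈ abstraction th d) :
    ∃ T', (w, T') ∈ abstraction th d' ∧ SetMatch r β β' T T' := by
  have hclosed : ∀ E : Set (Q × List Γ), (∀ s t, r s t → s ∈ E → t ∈ E) →
      prob d {u | push β u.1 ∈ E} = prob d' {u | push β' u.1 ∈ E} := by
    intro E hE
    rw [← toOuterMeasure_map_push hd, ← toOuterMeasure_map_push hd',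
      h.toOuterMeasure_eq hr hE]
  obtain ⟨hsupp, hth⟩ := hT
  refine ⟨{u' | ∃ u ∈ T, r (push β u.1) (push β' u'.1)} ∩ targetSupport d',
    ⟨Set.inter_subset_right, ?_⟩, fun u hu => ?_, fun u' hu' => ?_⟩
  · refine hth.trans ?_
    dsimp only
    rw [prob_inter_targetSupport]
    refine (prob_mono d ?_).trans
      (hclosed {x | ∃ u ∈ T, r (push β u.1) x} ?_).le
    · exact fun u hu => ⟨u, hu, hr.refl _⟩
    · rintro s t hst ⟨u, hu, hus⟩
      exact ⟨u, hu, hr.trans hus hst⟩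
  · have hpos : prob d {x | push β x.1 ∈ {y | r (push β u.1) y}} ≠ 0 := by
      intro h0
      have : prob d {u} ≤ 0 := h0 ▸ prob_mono d (Set.singleton_subset_iff.2 (hr.refl _))
      rw [prob, Set.image_singleton, PMF.toOuterMeasure_apply_singleton] at this
      exact hsupp hu (nonpos_iff_eq_zero.1 this)
    rw [hclosed {y | r (push β u.1) y} fun s t hst hs => hr.trans hs hst,
      ← prob_inter_targetSupport] at hpos
    obtain ⟨u', hu'⟩ : ({x | push β' x.1 ∈ {y | r (push β u.1) y}} ∩
        targetSupport d').Nonempty := by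
      by_contra hne
      rw [Set.not_nonempty_iff_eq_empty] at hne
      rw [hne] at hpos
      simp [prob] at hpos
    exact ⟨u', ⟨⟨u, hu, hu'.1⟩, hu'.2⟩, hu'.1⟩
  · obtain ⟨⟨u, hu, h⟩, -⟩ := hu'
    exact ⟨u, hu, hr.symm h⟩

theorem bisim_simulation_of_bisim (hwf : PPDAWf Δ) (th : W → ℝ≥0∞) {c c' : Q × List Γ}
    (h : Δ.plts.Bisim c c') : (Δ.simulation th).plts.Bisim (embed W c) (embed W c') := by
  obtain ⟨r, ⟨hr, hbis⟩, hcc⟩ := h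
  refine PLTS.bisim_of_transfer exists_pure_of_tr_simulation (liftRel.symm hr) ?_
    (.config c c' hcc)
  intro s t hst a s' hs
  cases hst with
  | config c c' h =>
    obtain ⟨q, l⟩ := c
    obtain ⟨p, l'⟩ := c'
    obtain ⟨X, β, a, d, rfl, rfl, hd, rfl⟩ := tr_embed_iff.1 hs
    obtain ⟨e, he, heq⟩ := hbis _ _ h a _ (plts_tr_iff.2 ⟨X, β, d, rfl, hd, rfl⟩)
    obtain ⟨Y, β', d', rfl, hd', rfl⟩ := plts_tr_iff.1 he
    exact ⟨_, tr_embed_iff.2 ⟨Y, β', a, d', rfl, rfl, hd', rfl⟩, .abstraction _ _ _ _ _ _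
      (exists_setMatch hr th (hwf _ _ _ _ hd) (hwf _ _ _ _ hd') heq)
      (exists_setMatch hr th (hwf _ _ _ _ hd') (hwf _ _ _ _ hd) fun x => (heq x).symm)⟩
  | abstraction q q' v v' β β' h h' =>
    obtain ⟨w, T, hT, rfl, rfl⟩ := tr_abstraction_iff.1 hs
    obtain ⟨T', hT', hm⟩ := h w T hT
    exact ⟨_, tr_abstraction_iff.2 ⟨w, T', hT', rfl, rfl⟩, .set _ _ _ _ _ _ hm⟩
  | set q q' T T' β β' h =>
    obtain ⟨u, hu, rfl, rfl⟩ := tr_set_iff.1 hs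
    obtain ⟨u', hu', hrel⟩ := h.1 u hu
    exact ⟨_, tr_set_iff.2 ⟨u', hu', rfl, rfl⟩, .config _ _ hrel⟩

/-- `d'` dominates `d` on a family of pairs of sets. -/
def Dominates (F : Set (Set (Target Q Γ) × Set (Target Q Γ))) (d d' : PMF (Q × List Γ)) : Prop :=
  ∀ x ∈ F, prob d x.1 ≤ prob d' x.2

/-- The thresholds suffice to recognise every failure to match a rule. -/
def Recognises (Δ : PPDARules Q Γ A) (th : W → ℝ≥0∞) : Prop :=
  ∀ q X a p Y F, (∃ d, Δ q X a d ∧ ∀ d', Δ p Y a d' → ¬ Dominates F d d') →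
    ∃ d, Δ q X a d ∧ (∀ d', Δ p Y a d' → ¬ Dominates F d d') ∧ ∀ T, ∃ w, th w = prob d T

/-- Finitely many thresholds suffice, even if there are infinitely many rules. -/
lemma exists_recognises (Δ : PPDARules Q Γ A) [Finite Q] [Finite Γ] [Finite A] :
    ∃ (W : Type) (_ : Finite W) (th : W → ℝ≥0∞), Δ.Recognises th := by
  classical
  let K : Type := Q × Γ × A × Q × Γ × Set (Set (Target Q Γ) × Set (Target Q Γ))
  let P : K → PMF (Q × List Γ) → Prop := fun k d =>
    Δ k.1 k.2.1 k.2.2.1 d ∧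
      ∀ d', Δ k.2.2.2.1 k.2.2.2.2.1 k.2.2.1 d' → ¬ Dominates k.2.2.2.2.2 d d'
  refine ⟨K × Set (Target Q Γ), inferInstance,
    fun w => if h : ∃ d, P w.1 d then prob h.choose w.2 else 0, ?_⟩
  intro q X a p Y F h
  have h' : ∃ d, P (q, X, a, p, Y, F) d := h
  exact ⟨h'.choose, h'.choose_spec.1, h'.choose_spec.2,
    fun T => ⟨((q, X, a, p, Y, F), T), dif_pos h'⟩⟩

lemma rEquiv_of_dominates {r : Q × List Γ → Q × List Γ → Prop} (hr : Equivalence r)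
    {d d' : PMF (Q × List Γ)} (hd : ∀ p (α : List Γ), d (p, α) ≠ 0 → α.length ≤ 2)
    (hd' : ∀ p (α : List Γ), d' (p, α) ≠ 0 → α.length ≤ 2) {β β' : List Γ}
    (h : ∀ E : Set (Q × List Γ), (∀ s t, r s t → s ∈ E → t ∈ E) →
      prob d {u | push β u.1 ∈ E} ≤ prob d' {u | push β' u.1 ∈ E}) :
    PLTS.REquiv r (d.map (push β)) (d'.map (push β')) := by
  intro s
  rw [PLTS.mass_eq_toOuterMeasure, PLTS.mass_eq_toOuterMeasure]
  have hle : ∀ E : Set (Q × List Γ), (∀ s t, r s t → s ∈ E → t ∈ E) →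
      (d.map (push β)).toOuterMeasure E ≤ (d'.map (push β')).toOuterMeasure E := by
    intro E hE
    rw [toOuterMeasure_map_push hd, toOuterMeasure_map_push hd']
    exact h E hE
  have hcompl : ∀ (e : PMF (Q × List Γ)) (E : Set (Q × List Γ)),
      e.toOuterMeasure E + e.toOuterMeasure Eᶜ = 1 := by
    intro e E
    rw [PMF.toOuterMeasure_apply, PMF.toOuterMeasure_apply, ← ENNReal.tsum_add, ← e.tsum_coe]
    exact tsum_congr fun x => Set.indicator_self_add_compl_apply E e x
  refine le_antisymm (hle _ fun x y hxy hx => hr.trans hx hxy) ?_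
  have hc := hle {t | r s t}ᶜ fun x y hxy hx hy => hx (hr.trans hy (hr.symm hxy))
  have hfin : (d'.map (push β')).toOuterMeasure {t | r s t}ᶜ ≠ ⊤ :=
    ne_top_of_le_ne_top ENNReal.one_ne_top (hcompl (d'.map (push β')) {t | r s t} ▸ le_add_self)
  refine (ENNReal.add_le_add_iff_right hfin).1 ?_
  rw [hcompl, ← hcompl (d.map (push β)) {t | r s t}]
  gcongr

theorem bisim_of_bisim_simulation (hwf : PPDAWf Δ) (hth : Δ.Recognises th) {c c' : Q × List Γ}
    (h : (Δ.simulation th).plts.Bisim (embed W c) (embed W c')) : Δ.plts.Bisim c c' := by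
  obtain ⟨r', hbis, hcc⟩ := h
  let r : Q × List Γ → Q × List Γ → Prop := fun c c' => r' (embed W c) (embed W c')
  have hr : Equivalence r :=
    ⟨fun _ => hbis.1.refl _, fun h => hbis.1.symm h, fun h h' => hbis.1.trans h h'⟩
  have htrans {s t : Q × List (StackSym Q Γ W)} (hst : r' s t) {a s'}
      (hs : (Δ.simulation th).plts.Tr s a (PMF.pure s')) :=
    hbis.transfer exists_pure_of_tr_simulation hst hs
  refine ⟨r, ⟨hr, ?_⟩, hcc⟩
  rintro ⟨q, l⟩ ⟨p, l'⟩ hst a e he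
  obtain ⟨X, β, d₀, rfl, hd₀, rfl⟩ := plts_tr_iff.1 he
  obtain ⟨Y, β', rfl⟩ : ∃ Y β', l' = Y :: β' := by
    obtain ⟨t, ht, -⟩ := htrans hst (tr_embed_iff.2 ⟨X, β, a, d₀, rfl, rfl, hd₀, rfl⟩)
    obtain ⟨Y, β', -, -, h, -⟩ := tr_embed_iff.1 ht
    exact ⟨Y, β', h⟩
  let F : Set (Set (Target Q Γ) × Set (Target Q Γ)) :=
    {x | ∃ E : Set (Q × List Γ), (∀ s t, r s t → s ∈ E → t ∈ E) ∧
      x = ({u | push β u.1 ∈ E}, {u | push β' u.1 ∈ E})}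
  have hmatch : ∃ d', Δ p Y a d' ∧ Dominates F d₀ d' := by
    by_contra! hcon
    obtain ⟨d, hd, hfail, hw⟩ := hth q X a p Y F ⟨d₀, hd₀, hcon⟩
    obtain ⟨t, ht, hrt⟩ := htrans hst (tr_embed_iff.2 ⟨X, β, a, d, rfl, rfl, hd, rfl⟩)
    obtain ⟨_, _, _, d', hcons, ha, hd', rfl⟩ := tr_embed_iff.1 ht
    obtain ⟨rfl, rfl⟩ := List.cons.inj hcons
    obtain rfl := Sum.inl.inj ha
    refine hfail d' hd' ?_
    rintro _ ⟨E, hE, rfl⟩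
    by_contra! hlt
    obtain ⟨w, hw⟩ := hw {u | push β u.1 ∈ E}
    obtain ⟨t, ht, hrt⟩ := htrans hrt (tr_abstraction_iff.2
      ⟨w, {u | push β u.1 ∈ E} ∩ targetSupport d,
        ⟨Set.inter_subset_right, by dsimp only; rw [prob_inter_targetSupport, hw]⟩, rfl, rfl⟩)
    obtain ⟨w', T', hT', hww, rfl⟩ := tr_abstraction_iff.1 ht
    obtain rfl := Option.some.inj (Sum.inr.inj hww)
    obtain ⟨u', hu', hnot⟩ : ∃ u' ∈ T', push β' u'.1 ∉ E := by
      by_contra! hsub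
      exact absurd ((hw ▸ hT'.2).trans (prob_mono d' hsub)) hlt.not_ge
    obtain ⟨t, ht, hrt⟩ := htrans (hbis.1.symm hrt) (tr_set_iff.2 ⟨u', hu', rfl, rfl⟩)
    obtain ⟨u, hu, -, rfl⟩ := tr_set_iff.1 ht
    exact hnot (hE _ _ (hr.symm hrt) hu.1)
  obtain ⟨d', hd', hdom⟩ := hmatch
  exact ⟨_, plts_tr_iff.2 ⟨Y, β', d', rfl, hd', rfl⟩,
    rEquiv_of_dominates hr (hwf _ _ _ _ hd₀) (hwf _ _ _ _ hd') fun E hE => hdom _ ⟨E, hE, rfl⟩⟩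

end PPDARules

/-- For every pPDA `Δ = (Q, Γ, A, ↪)` there is a
(nondeterministic) PDA `Δ' = (Q, Γ', A', ↪')` with `Γ ⊆ Γ'` (via `ιΓ`) and
`A ⊆ A'` (via `ιA`) such that any two configurations of `Δ` are bisimilar in
`S(Δ)` iff they are bisimilar (as configurations of `Δ'`) in `S(Δ')`.
Moreover `Δ'` has the same control states `Q`, so if `Δ` is a pBPA (single
control state) then `Δ'` is a BPA. -/
theorem ppda_to_pda (Q Γ A : Type) [Fintype Q] [Fintype Γ] [Fintype A]
    (Δ : PPDARules Q Γ A) (hwf : PPDAWf Δ) :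
    ∃ (Γ' A' : Type) (_ : Fintype Γ') (_ : Fintype A')
      (ιΓ : Γ ↪ Γ') (ιA : A ↪ A') (Δ' : PPDARules Q Γ' A'),
      IsPDA Δ' ∧ PPDAWf Δ' ∧
      ∀ (q₁ q₂ : Q) (γ₁ γ₂ : List Γ),
        Δ.plts.Bisim (q₁, γ₁) (q₂, γ₂) ↔
          Δ'.plts.Bisim (q₁, γ₁.map ιΓ) (q₂, γ₂.map ιΓ) := by
  classical
  obtain ⟨W, _, th, hth⟩ := Δ.exists_recognises
  refine ⟨PPDARules.StackSym Q Γ W, A ⊕ Option W, Fintype.ofFinite _, Fintype.ofFinite _,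
    .inl, .inl, Δ.simulation th, PPDARules.isPDA_simulation, PPDARules.pPDAWf_simulation, ?_⟩
  intro q₁ q₂ γ₁ γ₂
  exact ⟨PPDARules.bisim_simulation_of_bisim hwf th,
    PPDARules.bisim_of_bisim_simulation (c := (q₁, γ₁)) (c' := (q₂, γ₂)) hwf hth⟩
end
end

section
/- Let Δ = (Q, Γ, {a}, ↪) be a unary nondeterministic PDA with control-state partition Q = Q₀ ∪ Q₁ and initial configuration p₀X₀, in which every configuration has at most two successor configurations and no configuration with empty stack is reachable, and let Δ̄ be the fully probabilistic visibly pushdown automaton constructed from Δ as described. Then p₀X₀ ∼ p₀'X₀ in S(Δ̄) if and only if Player 0 can win the reachability game on S(Δ) from p₀X₀. -/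
open scoped ENNReal

noncomputable section

/-- The distribution giving each of `x`, `y` probability `1/2`. -/
def twoPoint {α : Type} (x y : α) : PMF α :=
  (PMF.bernoulli (1 / 2) (by norm_num)).map (fun b => if b then x else y)

/-- Description of the rules of a unary nondeterministic PDA in which every
head `pX` is dead, has exactly one successor `qα`, or has exactly two
successor configurations `p₁X₁`, `p₂X₂` (with single stack symbols, w.l.o.g.). -/
inductive RuleKind (Q Γ : Type) : Type
  | dead : RuleKind Q Γ
  | one (q : Q) (α : List Γ) : RuleKind Q Γ
  | two (p₁ : Q) (X₁ : Γ) (p₂ : Q) (X₂ : Γ) : RuleKind Q Γ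

/-- The successor relation on configurations induced by the rules. -/
def RSucc {Q Γ : Type} (rule : Q → Γ → RuleKind Q Γ) :
    Q × List Γ → Q × List Γ → Prop := fun c c' =>
  ∃ p X γ, c = (p, X :: γ) ∧
    ((∃ q α, rule p X = RuleKind.one q α ∧ c' = (q, α ++ γ)) ∨
     (∃ p₁ X₁ p₂ X₂, rule p X = RuleKind.two p₁ X₁ p₂ X₂ ∧
        (c' = (p₁, X₁ :: γ) ∨ c' = (p₂, X₂ :: γ))))

/-- Player 0 wins the reachability game from `c₀`: `c₀` lies in a set `W` of
configurations such that every `c ∈ W` is not dead, if the control state of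
`c` belongs to Player 0 then some successor of `c` is in `W`, and if it
belongs to Player 1 then all successors of `c` are in `W`. -/
def Player0Wins {Q Γ : Type} (Q0 : Set Q) (rule : Q → Γ → RuleKind Q Γ)
    (c₀ : Q × List Γ) : Prop :=
  ∃ W : Set (Q × List Γ), c₀ ∈ W ∧ ∀ c ∈ W,
    (∃ c', RSucc rule c c') ∧
    (c.1 ∈ Q0 → ∃ c' ∈ W, RSucc rule c c') ∧
    (c.1 ∉ Q0 → ∀ c', RSucc rule c c' → c' ∈ W)

/-- The three actions of the constructed pvPDA: a pop, an internal and a push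
action. -/
inductive Act3 : Type
  | ar : Act3
  | aint : Act3
  | ac : Act3

/-- The action used to mimic a rule rewriting the top symbol into a string of
length `n`: pop for `n = 0`, internal for `n = 1`, push for `n = 2`. -/
def actOf (n : ℕ) : Act3 :=
  if n = 0 then Act3.ar else if n = 1 then Act3.aint else Act3.ac

/-- Control states of the constructed pvPDA: the states `p` (`base`) and `p'`
(`prim`) for each original control state `p`, the dead state `z`, and the
fresh gadget states of the OR- and AND-gadgets (indexed by the head `pX` they
belong to, and by which copies—primed or not—they point to). -/
inductive BQ (Q Γ : Type) : Type
  | base (p : Q) : BQ Q Γ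
  | prim (p : Q) : BQ Q Γ
  | z : BQ Q Γ
  | orS (p : Q) (X : Γ) (b₁ b₂ : Bool) : BQ Q Γ
  | andS (p : Q) (X : Γ) (i : Bool) (b : Bool) : BQ Q Γ

/-- The primed (`b = true`) or unprimed (`b = false`) copy of `p`. -/
def primIf {Q Γ : Type} (b : Bool) (p : Q) : BQ Q Γ :=
  cond b (BQ.prim p) (BQ.base p)

/-- The rules of the fully probabilistic pvPDA `Δ̄` constructed from the unary
PDA given by `rule` with control-state partition `Q = Q0 ∪ (Q \ Q0)`. -/
inductive BarRule {Q Γ : Type} (Q0 : Set Q) (rule : Q → Γ → RuleKind Q Γ) :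
    BQ Q Γ → Γ → Act3 → PMF (BQ Q Γ × List Γ) → Prop
  /- dead heads -/
  | dead₁ (p : Q) (X : Γ) (h : rule p X = RuleKind.dead) :
      BarRule Q0 rule (BQ.base p) X Act3.aint (PMF.pure (BQ.base p, [X]))
  | dead₂ (p : Q) (X : Γ) (h : rule p X = RuleKind.dead) :
      BarRule Q0 rule (BQ.prim p) X Act3.aint (PMF.pure (BQ.z, [X]))
  /- heads with a single successor -/
  | one₁ (p : Q) (X : Γ) (q : Q) (α : List Γ) (h : rule p X = RuleKind.one q α) :
      BarRule Q0 rule (BQ.base p) X (actOf α.length) (PMF.pure (BQ.base q, α))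
  | one₂ (p : Q) (X : Γ) (q : Q) (α : List Γ) (h : rule p X = RuleKind.one q α) :
      BarRule Q0 rule (BQ.prim p) X (actOf α.length) (PMF.pure (BQ.prim q, α))
  /- OR-gadget for heads `pX` with two successors and `p ∈ Q0` -/
  | or₀ (p : Q) (X : Γ) (p₁ : Q) (X₁ : Γ) (p₂ : Q) (X₂ : Γ)
      (hp : p ∈ Q0) (h : rule p X = RuleKind.two p₁ X₁ p₂ X₂) :
      BarRule Q0 rule (BQ.base p) X Act3.aint
        (twoPoint (BQ.orS p X false false, [X]) (BQ.orS p X true true, [X]))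
  | or₀' (p : Q) (X : Γ) (p₁ : Q) (X₁ : Γ) (p₂ : Q) (X₂ : Γ)
      (hp : p ∈ Q0) (h : rule p X = RuleKind.two p₁ X₁ p₂ X₂) :
      BarRule Q0 rule (BQ.prim p) X Act3.aint
        (twoPoint (BQ.orS p X false true, [X]) (BQ.orS p X true false, [X]))
  | orT (p : Q) (X : Γ) (p₁ : Q) (X₁ : Γ) (p₂ : Q) (X₂ : Γ) (b₁ b₂ : Bool)
      (hp : p ∈ Q0) (h : rule p X = RuleKind.two p₁ X₁ p₂ X₂) :
      BarRule Q0 rule (BQ.orS p X b₁ b₂) X Act3.aint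
        (twoPoint (primIf b₁ p₁, [X₁]) (primIf b₂ p₂, [X₂]))
  /- AND-gadget for heads `pX` with two successors and `p ∈ Q1 = Q \ Q0` -/
  | and₀ (p : Q) (X : Γ) (p₁ : Q) (X₁ : Γ) (p₂ : Q) (X₂ : Γ)
      (hp : p ∉ Q0) (h : rule p X = RuleKind.two p₁ X₁ p₂ X₂) :
      BarRule Q0 rule (BQ.base p) X Act3.aint
        (twoPoint (BQ.andS p X false false, [X]) (BQ.andS p X true false, [X]))
  | and₀' (p : Q) (X : Γ) (p₁ : Q) (X₁ : Γ) (p₂ : Q) (X₂ : Γ)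
      (hp : p ∉ Q0) (h : rule p X = RuleKind.two p₁ X₁ p₂ X₂) :
      BarRule Q0 rule (BQ.prim p) X Act3.aint
        (twoPoint (BQ.andS p X false true, [X]) (BQ.andS p X true true, [X]))
  | andT₁ (p : Q) (X : Γ) (p₁ : Q) (X₁ : Γ) (p₂ : Q) (X₂ : Γ) (b : Bool)
      (hp : p ∉ Q0) (h : rule p X = RuleKind.two p₁ X₁ p₂ X₂) :
      BarRule Q0 rule (BQ.andS p X false b) X Act3.aint
        (PMF.pure (primIf b p₁, [X₁]))
  | andT₂ (p : Q) (X : Γ) (p₁ : Q) (X₁ : Γ) (p₂ : Q) (X₂ : Γ) (b : Bool)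
      (hp : p ∉ Q0) (h : rule p X = RuleKind.two p₁ X₁ p₂ X₂) :
      BarRule Q0 rule (BQ.andS p X true b) X Act3.aint
        (twoPoint (primIf b p₂, [X₂]) (BQ.z, [X]))

namespace PLTS

variable {S A : Type} {r : S → S → Prop}

open Classical in
lemma two_mul_mass_twoPoint (x y : S) (E : Set S) :
    2 * mass (twoPoint x y) E =
      (((if x ∈ E then 1 else 0) + (if y ∈ E then 1 else 0) : ℕ) : ℝ≥0∞) := by
  have key : mass (twoPoint x y) E =
      (if x ∈ E then 2⁻¹ else 0) + (if y ∈ E then 2⁻¹ else 0) := by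
    have hmass : mass (twoPoint x y) E = (twoPoint x y).toOuterMeasure E := by
      rw [PMF.toOuterMeasure_apply, mass, tsum_subtype]
    rw [hmass, twoPoint, PMF.toOuterMeasure_map_apply, PMF.toOuterMeasure_apply, tsum_fintype,
      Fintype.sum_bool]
    simp [Set.indicator_apply, PMF.bernoulli_apply]
  rw [key, mul_add]
  split_ifs <;> simp [ENNReal.mul_inv_cancel, one_add_one_eq_two]

lemma rEquiv_twoPoint_iff (hr : Equivalence r) {x y x' y' : S} :
    REquiv r (twoPoint x y) (twoPoint x' y') ↔ (r x x' ∧ r y y') ∨ (r x y' ∧ r y x') := by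
  classical
  have mass_eq_iff (E : Set S) : mass (twoPoint x y) E = mass (twoPoint x' y') E ↔
      (if x ∈ E then 1 else 0) + (if y ∈ E then 1 else 0) =
        (if x' ∈ E then 1 else 0) + (if y' ∈ E then 1 else 0) := by
    rw [← ENNReal.mul_right_inj (a := 2) (by simp) (by simp), two_mul_mass_twoPoint,
      two_mul_mass_twoPoint, Nat.cast_inj]
  have hrefl := hr.refl
  have hsymm := @hr.symm
  have htrans := @hr.trans
  simp only [REquiv, mass_eq_iff, Set.mem_ofPred_eq]
  constructor
  · intro h
    have hx := h x
    have hy := h y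
    grind
  · intro h s
    grind

lemma REquiv.symm {d d' : PMF S} (h : REquiv r d d') : REquiv r d' d := fun s => (h s).symm

lemma REquiv.trans {d d' d'' : PMF S} (h : REquiv r d d') (h' : REquiv r d' d'') :
    REquiv r d d'' := fun s => (h s).trans (h' s)

/-- The kernel of `f` is a bisimulation as soon as every `s` and `f s` match each other's
transitions. -/
lemma isBisimulation_ker (L : PLTS S A) (f : S → S)
    (hf : ∀ s a d, L.Tr s a d → ∃ d', L.Tr (f s) a d' ∧ REquiv (fun s t => f s = f t) d d')
    (hf' : ∀ s a d, L.Tr (f s) a d → ∃ d', L.Tr s a d' ∧ REquiv (fun s t => f s = f t) d d') :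
    L.IsBisimulation (fun s t => f s = f t) := by
  refine ⟨⟨fun _ => rfl, fun h => h.symm, fun h h' => h.trans h'⟩, fun s t hst a d hd => ?_⟩
  obtain ⟨d₁, h₁, e₁⟩ := hf s a d hd
  obtain ⟨d₂, h₂, e₂⟩ := hf' t a d₁ (hst ▸ h₁)
  exact ⟨d₂, h₂, e₁.trans e₂⟩

end PLTS

lemma twoPoint_map {α β : Type} (f : α → β) (x y : α) :
    (twoPoint x y).map f = twoPoint (f x) (f y) := by
  rw [twoPoint, PMF.map_comp, twoPoint]
  congr 1
  funext b
  cases b <;> rfl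

lemma twoPoint_self {α : Type} (x : α) : twoPoint x x = PMF.pure x := by
  simp only [twoPoint, ite_self]
  exact PMF.map_const _ _

section BarSystem

variable {Q Γ : Type} (Q0 : Set Q) (rule : Q → Γ → RuleKind Q Γ)

/-- The pLTS of the constructed pvPDA. -/
abbrev barPlts : PLTS (BQ Q Γ × List Γ) Act3 :=
  PPDARules.plts (BarRule Q0 rule : PPDARules (BQ Q Γ) Γ Act3)

variable {Q0 rule}

lemma BarRule.det {q : BQ Q Γ} {X : Γ} {a a' : Act3} {d d' : PMF (BQ Q Γ × List Γ)}
    (h : BarRule Q0 rule q X a d) (h' : BarRule Q0 rule q X a' d') : a = a' ∧ d = d' := by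
  cases h <;> cases h' <;> simp_all

lemma barPlts_det {s : BQ Q Γ × List Γ} {a a' : Act3} {d d' : PMF (BQ Q Γ × List Γ)}
    (h : (barPlts Q0 rule).Tr s a d) (h' : (barPlts Q0 rule).Tr s a' d') :
    a = a' ∧ d = d' := by
  obtain ⟨q, X, γ, e, rfl, he, rfl⟩ := h
  obtain ⟨q', X', γ', e', heq, he', rfl⟩ := h'
  simp only [Prod.mk.injEq, List.cons.injEq] at heq
  obtain ⟨rfl, rfl, rfl⟩ := heq
  obtain ⟨rfl, rfl⟩ := he.det he'
  exact ⟨rfl, rfl⟩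

lemma BarRule.tr_twoPoint {q : BQ Q Γ} {X : Γ} {a : Act3} {x y : BQ Q Γ × List Γ}
    (h : BarRule Q0 rule q X a (twoPoint x y)) (γ : List Γ) :
    (barPlts Q0 rule).Tr (q, X :: γ) a (twoPoint (x.1, x.2 ++ γ) (y.1, y.2 ++ γ)) :=
  ⟨q, X, γ, _, rfl, h, by rw [twoPoint_map]⟩

lemma BarRule.tr_pure {q : BQ Q Γ} {X : Γ} {a : Act3} {x : BQ Q Γ × List Γ}
    (h : BarRule Q0 rule q X a (PMF.pure x)) (γ : List Γ) :
    (barPlts Q0 rule).Tr (q, X :: γ) a (twoPoint (x.1, x.2 ++ γ) (x.1, x.2 ++ γ)) :=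
  BarRule.tr_twoPoint (twoPoint_self x ▸ h) γ

lemma exists_barRule_primIf (b : Bool) (p : Q) (X : Γ) :
    ∃ a d, BarRule Q0 rule (primIf b p) X a d := by
  cases h : rule p X with
  | dead => cases b; exacts [⟨_, _, .dead₁ p X h⟩, ⟨_, _, .dead₂ p X h⟩]
  | one q α => cases b; exacts [⟨_, _, .one₁ p X q α h⟩, ⟨_, _, .one₂ p X q α h⟩]
  | two p₁ X₁ p₂ X₂ =>
    by_cases hp : p ∈ Q0
    · cases b; exacts [⟨_, _, .or₀ p X _ _ _ _ hp h⟩, ⟨_, _, .or₀' p X _ _ _ _ hp h⟩]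
    · cases b; exacts [⟨_, _, .and₀ p X _ _ _ _ hp h⟩, ⟨_, _, .and₀' p X _ _ _ _ hp h⟩]

lemma exists_tr_primIf (b : Bool) (p : Q) (X : Γ) (γ : List Γ) :
    ∃ a d, (barPlts Q0 rule).Tr (primIf b p, X :: γ) a d :=
  let ⟨a, _, h⟩ := exists_barRule_primIf b p X
  ⟨a, _, _, X, γ, _, rfl, h, rfl⟩

lemma not_tr_z {α : List Γ} {a : Act3} {d : PMF (BQ Q Γ × List Γ)} :
    ¬ (barPlts Q0 rule).Tr (BQ.z, α) a d := by
  rintro ⟨q, X, γ, e, heq, he, -⟩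
  obtain ⟨rfl, -⟩ := Prod.mk.inj heq
  cases he

lemma rSucc_cons_iff {p : Q} {X : Γ} {γ : List Γ} {c : Q × List Γ} :
    RSucc rule (p, X :: γ) c ↔
      (∃ q α, rule p X = RuleKind.one q α ∧ c = (q, α ++ γ)) ∨
       (∃ p₁ X₁ p₂ X₂, rule p X = RuleKind.two p₁ X₁ p₂ X₂ ∧
          (c = (p₁, X₁ :: γ) ∨ c = (p₂, X₂ :: γ))) := by
  constructor
  · rintro ⟨_, _, _, heq, h⟩
    simp only [Prod.mk.injEq, List.cons.injEq] at heq
    obtain ⟨rfl, rfl, rfl⟩ := heq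
    exact h
  · exact fun h => ⟨p, X, γ, rfl, h⟩

lemma not_rSucc_of_dead {p : Q} {X : Γ} (h : rule p X = RuleKind.dead) {γ : List Γ}
    {c : Q × List Γ} : ¬ RSucc rule (p, X :: γ) c := by
  simp [rSucc_cons_iff, h]

lemma rSucc_one_iff {p q : Q} {X : Γ} {α : List Γ} (h : rule p X = RuleKind.one q α)
    {γ : List Γ} {c : Q × List Γ} : RSucc rule (p, X :: γ) c ↔ c = (q, α ++ γ) := by
  rw [rSucc_cons_iff]
  grind

lemma rSucc_two_iff {p p₁ p₂ : Q} {X X₁ X₂ : Γ} (h : rule p X = RuleKind.two p₁ X₁ p₂ X₂)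
    {γ : List Γ} {c : Q × List Γ} :
    RSucc rule (p, X :: γ) c ↔ c = (p₁, X₁ :: γ) ∨ c = (p₂, X₂ :: γ) := by
  rw [rSucc_cons_iff]
  grind

section Completeness

variable {r : BQ Q Γ × List Γ → BQ Q Γ × List Γ → Prop}

lemma PLTS.IsBisimulation.twoPoint_cases (hr : (barPlts Q0 rule).IsBisimulation r)
    {s t x y x' y' : BQ Q Γ × List Γ} {a a' : Act3} (hst : r s t)
    (hs : (barPlts Q0 rule).Tr s a (twoPoint x y))
    (ht : (barPlts Q0 rule).Tr t a' (twoPoint x' y')) :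
    (r x x' ∧ r y y') ∨ (r x y' ∧ r y x') := by
  obtain ⟨d, hd, e⟩ := hr.2 s t hst _ _ hs
  obtain ⟨-, rfl⟩ := barPlts_det hd ht
  exact (PLTS.rEquiv_twoPoint_iff hr.1).1 e

lemma PLTS.IsBisimulation.not_base_z (hr : (barPlts Q0 rule).IsBisimulation r)
    (p : Q) (X : Γ) (γ α : List Γ) : ¬ r (BQ.base p, X :: γ) (BQ.z, α) := by
  intro h
  obtain ⟨a, d, hd⟩ := exists_tr_primIf (Q0 := Q0) (rule := rule) false p X γ
  obtain ⟨d', hd', -⟩ := hr.2 _ _ h a d hd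
  exact not_tr_z hd'

lemma PLTS.IsBisimulation.rule_ne_dead (hr : (barPlts Q0 rule).IsBisimulation r)
    {p : Q} {X : Γ} {γ : List Γ} (h : r (BQ.base p, X :: γ) (BQ.prim p, X :: γ)) :
    rule p X ≠ RuleKind.dead := by
  intro hd
  have := hr.twoPoint_cases h (BarRule.dead₁ p X hd |>.tr_pure γ) (BarRule.dead₂ p X hd |>.tr_pure γ)
  have hz := hr.not_base_z p X γ ([X] ++ γ)
  simp_all

lemma PLTS.IsBisimulation.one (hr : (barPlts Q0 rule).IsBisimulation r)
    {p q : Q} {X : Γ} {α γ : List Γ} (h : r (BQ.base p, X :: γ) (BQ.prim p, X :: γ))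
    (hrule : rule p X = RuleKind.one q α) :
    r (BQ.base q, α ++ γ) (BQ.prim q, α ++ γ) := by
  have := hr.twoPoint_cases h (BarRule.one₁ p X q α hrule |>.tr_pure γ)
    (BarRule.one₂ p X q α hrule |>.tr_pure γ)
  simpa using this

lemma PLTS.IsBisimulation.or_gadget (hr : (barPlts Q0 rule).IsBisimulation r)
    {p p₁ p₂ : Q} {X X₁ X₂ : Γ} {γ : List Γ} (h : r (BQ.base p, X :: γ) (BQ.prim p, X :: γ))
    (hp : p ∈ Q0) (hrule : rule p X = RuleKind.two p₁ X₁ p₂ X₂) :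
    r (BQ.base p₁, X₁ :: γ) (BQ.prim p₁, X₁ :: γ) ∨
      r (BQ.base p₂, X₂ :: γ) (BQ.prim p₂, X₂ :: γ) := by
  have hT (b₁ b₂) := BarRule.orT p X _ _ _ _ b₁ b₂ hp hrule |>.tr_twoPoint γ
  have hrefl := hr.1.refl
  have hsymm := @hr.1.symm
  have htrans := @hr.1.trans
  rcases hr.twoPoint_cases h (BarRule.or₀ p X _ _ _ _ hp hrule |>.tr_twoPoint γ)
    (BarRule.or₀' p X _ _ _ _ hp hrule |>.tr_twoPoint γ) with ⟨h₁, -⟩ | ⟨h₁, -⟩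
  · have := hr.twoPoint_cases h₁ (hT false false) (hT false true)
    simp only [primIf, cond_true, cond_false, List.cons_append, List.nil_append] at this
    grind
  · have := hr.twoPoint_cases h₁ (hT false false) (hT true false)
    simp only [primIf, cond_true, cond_false, List.cons_append, List.nil_append] at this
    grind

lemma PLTS.IsBisimulation.and_gadget (hr : (barPlts Q0 rule).IsBisimulation r)
    {p p₁ p₂ : Q} {X X₁ X₂ : Γ} {γ : List Γ} (h : r (BQ.base p, X :: γ) (BQ.prim p, X :: γ))
    (hp : p ∉ Q0) (hrule : rule p X = RuleKind.two p₁ X₁ p₂ X₂) :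
    r (BQ.base p₁, X₁ :: γ) (BQ.prim p₁, X₁ :: γ) ∧
      r (BQ.base p₂, X₂ :: γ) (BQ.prim p₂, X₂ :: γ) := by
  have hT₁ (b) := BarRule.andT₁ p X _ _ _ _ b hp hrule |>.tr_pure γ
  have hT₂ (b) := BarRule.andT₂ p X _ _ _ _ b hp hrule |>.tr_twoPoint γ
  have hz₁ := hr.not_base_z p₁ X₁ γ (X :: γ)
  have hz₂ := hr.not_base_z p₂ X₂ γ (X :: γ)
  rcases hr.twoPoint_cases h (BarRule.and₀ p X _ _ _ _ hp hrule |>.tr_twoPoint γ)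
    (BarRule.and₀' p X _ _ _ _ hp hrule |>.tr_twoPoint γ) with ⟨h₁, h₂⟩ | ⟨h₁, -⟩
  · have h₁' := hr.twoPoint_cases h₁ (hT₁ false) (hT₁ true)
    have h₂' := hr.twoPoint_cases h₂ (hT₂ false) (hT₂ true)
    simp only [primIf, cond_true, cond_false, List.cons_append, List.nil_append] at h₁' h₂'
    grind
  · have := hr.twoPoint_cases h₁ (hT₁ false) (hT₂ true)
    simp only [primIf, cond_true, cond_false, List.cons_append, List.nil_append] at this
    grind

lemma player0Wins_of_bisim {c₀ : Q × List Γ}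
    (hnoempty : ∀ p : Q, ¬ Relation.ReflTransGen (RSucc rule) c₀ (p, []))
    (h : (barPlts Q0 rule).Bisim (BQ.base c₀.1, c₀.2) (BQ.prim c₀.1, c₀.2)) :
    Player0Wins Q0 rule c₀ := by
  obtain ⟨r, hr, h⟩ := h
  refine ⟨{c | Relation.ReflTransGen (RSucc rule) c₀ c ∧ r (BQ.base c.1, c.2) (BQ.prim c.1, c.2)},
    ⟨.refl, h⟩, ?_⟩
  rintro ⟨p, _ | ⟨X, γ⟩⟩ ⟨hreach, hrel⟩
  · exact absurd hreach (hnoempty p)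
  cases hrule : rule p X with
  | dead => exact absurd hrule (hr.rule_ne_dead hrel)
  | one q α =>
    have hsucc : RSucc rule (p, X :: γ) (q, α ++ γ) := (rSucc_one_iff hrule).2 rfl
    have hmem := hr.one hrel hrule
    refine ⟨⟨_, hsucc⟩, fun _ => ⟨_, ⟨hreach.tail hsucc, hmem⟩, hsucc⟩, fun _ c' hc' => ?_⟩
    refine ⟨hreach.tail hc', ?_⟩
    obtain rfl := (rSucc_one_iff hrule).1 hc'
    exact hmem
  | two p₁ X₁ p₂ X₂ =>
    have hsucc₁ : RSucc rule (p, X :: γ) (p₁, X₁ :: γ) := (rSucc_two_iff hrule).2 (.inl rfl)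
    have hsucc₂ : RSucc rule (p, X :: γ) (p₂, X₂ :: γ) := (rSucc_two_iff hrule).2 (.inr rfl)
    refine ⟨⟨_, hsucc₁⟩, fun hp => ?_, fun hp c' hc' => ⟨hreach.tail hc', ?_⟩⟩
    · rcases hr.or_gadget hrel hp hrule with hmem | hmem
      · exact ⟨_, ⟨hreach.tail hsucc₁, hmem⟩, hsucc₁⟩
      · exact ⟨_, ⟨hreach.tail hsucc₂, hmem⟩, hsucc₂⟩
    · obtain ⟨hmem₁, hmem₂⟩ := hr.and_gadget hrel hp hrule
      obtain rfl | rfl := (rSucc_two_iff hrule).1 hc'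
      exacts [hmem₁, hmem₂]

end Completeness

section Soundness

variable (rule) (W : Set (Q × List Γ))

open Classical in
/-- Clears a prime mark that refers to a configuration of `W`. -/
def unprimeBit (c : Q × List Γ) (b : Bool) : Bool := b && decide (c ∉ W)

/-- The representative of a configuration of the pvPDA in which all prime marks that refer to
configurations of `W` are cleared. -/
def unprime : BQ Q Γ × List Γ → BQ Q Γ × List Γ
  | (BQ.prim p, α) => (primIf (unprimeBit W (p, α) true) p, α)
  | (BQ.orS p X b₁ b₂, Y :: γ) =>
    match rule p X with
    | RuleKind.two p₁ X₁ p₂ X₂ =>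
      (BQ.orS p X (unprimeBit W (p₁, X₁ :: γ) b₁) (unprimeBit W (p₂, X₂ :: γ) b₂), Y :: γ)
    | _ => (BQ.orS p X b₁ b₂, Y :: γ)
  | (BQ.andS p X i b, Y :: γ) =>
    match rule p X with
    | RuleKind.two p₁ X₁ p₂ X₂ =>
      (BQ.andS p X i (unprimeBit W (cond i (p₂, X₂ :: γ) (p₁, X₁ :: γ)) b), Y :: γ)
    | _ => (BQ.andS p X i b, Y :: γ)
  | c => c

variable {rule W}

@[simp] lemma unprimeBit_false (c : Q × List Γ) : unprimeBit W c false = false := rfl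

@[simp] lemma unprimeBit_unprimeBit (c : Q × List Γ) (b : Bool) :
    unprimeBit W c (unprimeBit W c b) = unprimeBit W c b := by
  simp [unprimeBit]

lemma unprimeBit_of_mem {c : Q × List Γ} (h : c ∈ W) (b : Bool) : unprimeBit W c b = false := by
  simp [unprimeBit, h]

lemma unprimeBit_of_notMem {c : Q × List Γ} (h : c ∉ W) (b : Bool) : unprimeBit W c b = b := by
  simp [unprimeBit, h]

lemma unprime_base (p : Q) (α : List Γ) : unprime rule W (BQ.base p, α) = (BQ.base p, α) := rfl

lemma unprime_primIf (b : Bool) (p : Q) (α : List Γ) :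
    unprime rule W (primIf b p, α) = (primIf (unprimeBit W (p, α) b) p, α) := by
  cases b <;> rfl

lemma unprime_prim (p : Q) (α : List Γ) :
    unprime rule W (BQ.prim p, α) = (primIf (unprimeBit W (p, α) true) p, α) := rfl

lemma unprime_orS {p p₁ p₂ : Q} {X X₁ X₂ : Γ} (h : rule p X = RuleKind.two p₁ X₁ p₂ X₂)
    (b₁ b₂ : Bool) (Y : Γ) (γ : List Γ) :
    unprime rule W (BQ.orS p X b₁ b₂, Y :: γ) =
      (BQ.orS p X (unprimeBit W (p₁, X₁ :: γ) b₁) (unprimeBit W (p₂, X₂ :: γ) b₂), Y :: γ) := by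
  simp [unprime, h]

lemma unprime_andS {p p₁ p₂ : Q} {X X₁ X₂ : Γ} (h : rule p X = RuleKind.two p₁ X₁ p₂ X₂)
    (i b : Bool) (Y : Γ) (γ : List Γ) :
    unprime rule W (BQ.andS p X i b, Y :: γ) =
      (BQ.andS p X i (unprimeBit W (cond i (p₂, X₂ :: γ) (p₁, X₁ :: γ)) b), Y :: γ) := by
  simp [unprime, h]

/-- `W` witnesses a win of Player 0. -/
def IsWinningSet (Q0 : Set Q) (rule : Q → Γ → RuleKind Q Γ) (W : Set (Q × List Γ)) : Prop :=
  ∀ c ∈ W, (∃ c', RSucc rule c c') ∧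
    (c.1 ∈ Q0 → ∃ c' ∈ W, RSucc rule c c') ∧
    (c.1 ∉ Q0 → ∀ c', RSucc rule c c' → c' ∈ W)

namespace IsWinningSet

lemma rule_ne_dead (hW : IsWinningSet Q0 rule W) {p : Q} {X : Γ} {γ : List Γ}
    (h : (p, X :: γ) ∈ W) : rule p X ≠ RuleKind.dead := fun hd =>
  let ⟨_, hc⟩ := (hW _ h).1
  not_rSucc_of_dead hd hc

lemma mem_of_one (hW : IsWinningSet Q0 rule W) {p q : Q} {X : Γ} {α γ : List Γ}
    (h : (p, X :: γ) ∈ W) (hrule : rule p X = RuleKind.one q α) : (q, α ++ γ) ∈ W := by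
  have := hW _ h
  simp only [rSucc_one_iff hrule] at this
  grind

lemma mem_or_mem (hW : IsWinningSet Q0 rule W) {p p₁ p₂ : Q} {X X₁ X₂ : Γ} {γ : List Γ}
    (h : (p, X :: γ) ∈ W) (hp : p ∈ Q0) (hrule : rule p X = RuleKind.two p₁ X₁ p₂ X₂) :
    (p₁, X₁ :: γ) ∈ W ∨ (p₂, X₂ :: γ) ∈ W := by
  have := (hW _ h).2.1 hp
  simp only [rSucc_two_iff hrule] at this
  grind

lemma mem_and_mem (hW : IsWinningSet Q0 rule W) {p p₁ p₂ : Q} {X X₁ X₂ : Γ} {γ : List Γ}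
    (h : (p, X :: γ) ∈ W) (hp : p ∉ Q0) (hrule : rule p X = RuleKind.two p₁ X₁ p₂ X₂) :
    (p₁, X₁ :: γ) ∈ W ∧ (p₂, X₂ :: γ) ∈ W := by
  have := (hW _ h).2.2 hp
  simp only [rSucc_two_iff hrule] at this
  grind

end IsWinningSet

lemma equivalence_unprime : Equivalence fun s t => unprime rule W s = unprime rule W t :=
  ⟨fun _ => rfl, fun h => h.symm, fun h h' => h.trans h'⟩

lemma exists_tr_of_twoPoint {t x y x' y' : BQ Q Γ × List Γ} {a : Act3}
    (ht : (barPlts Q0 rule).Tr t a (twoPoint x' y'))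
    (h : (unprime rule W x = unprime rule W x' ∧ unprime rule W y = unprime rule W y') ∨
      (unprime rule W x = unprime rule W y' ∧ unprime rule W y = unprime rule W x')) :
    ∃ d', (barPlts Q0 rule).Tr t a d' ∧
      PLTS.REquiv (fun s t => unprime rule W s = unprime rule W t) (twoPoint x y) d' :=
  ⟨_, ht, (PLTS.rEquiv_twoPoint_iff equivalence_unprime).2 h⟩

lemma IsWinningSet.tr_unprime (hW : IsWinningSet Q0 rule W) {s : BQ Q Γ × List Γ} {a : Act3}
    {d : PMF (BQ Q Γ × List Γ)} (h : (barPlts Q0 rule).Tr s a d) :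
    ∃ d', (barPlts Q0 rule).Tr (unprime rule W s) a d' ∧
      PLTS.REquiv (fun s t => unprime rule W s = unprime rule W t) d d' := by
  by_cases hs : unprime rule W s = s
  · exact ⟨d, hs.symm ▸ h, fun _ => rfl⟩
  obtain ⟨q, X, γ, e, rfl, he, rfl⟩ := h
  have mem_of_prim {p : Q} (hp : unprime rule W (BQ.prim p, X :: γ) ≠ (BQ.prim p, X :: γ)) :
      (p, X :: γ) ∈ W := by
    by_contra hmem
    exact hp (by rw [unprime_prim, unprimeBit_of_notMem hmem]; rfl)
  have unprime_of_mem {p : Q} (hp : (p, X :: γ) ∈ W) :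
      unprime rule W (BQ.prim p, X :: γ) = (BQ.base p, X :: γ) := by
    rw [unprime_prim, unprimeBit_of_mem hp]; rfl
  cases he with
  | dead₁ | one₁ | or₀ | and₀ => exact absurd rfl hs
  | dead₂ p _ hrule => exact absurd hrule (hW.rule_ne_dead (mem_of_prim hs))
  | one₂ p _ q α hrule =>
    rw [← twoPoint_self, twoPoint_map, unprime_of_mem (mem_of_prim hs)]
    refine exists_tr_of_twoPoint (BarRule.one₁ p X q α hrule |>.tr_pure γ) ?_
    simp [unprime_prim, unprime_base, unprimeBit_of_mem (hW.mem_of_one (mem_of_prim hs) hrule),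
      primIf]
  | or₀' p _ p₁ X₁ p₂ X₂ hp hrule =>
    rw [twoPoint_map, unprime_of_mem (mem_of_prim hs)]
    refine exists_tr_of_twoPoint (BarRule.or₀ p X _ _ _ _ hp hrule |>.tr_twoPoint γ) ?_
    simp only [List.cons_append, List.nil_append, unprime_orS hrule]
    rcases hW.mem_or_mem (mem_of_prim hs) hp hrule with hmem | hmem <;>
      simp [unprimeBit_of_mem hmem]
  | orT p _ p₁ X₁ p₂ X₂ b₁ b₂ hp hrule =>
    rw [twoPoint_map, unprime_orS hrule]
    refine exists_tr_of_twoPoint (BarRule.orT p X _ _ _ _ _ _ hp hrule |>.tr_twoPoint γ) ?_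
    simp [unprime_primIf]
  | and₀' p _ p₁ X₁ p₂ X₂ hp hrule =>
    rw [twoPoint_map, unprime_of_mem (mem_of_prim hs)]
    refine exists_tr_of_twoPoint (BarRule.and₀ p X _ _ _ _ hp hrule |>.tr_twoPoint γ) ?_
    obtain ⟨hmem₁, hmem₂⟩ := hW.mem_and_mem (mem_of_prim hs) hp hrule
    simp [unprime_andS hrule, unprimeBit_of_mem hmem₁, unprimeBit_of_mem hmem₂]
  | andT₁ p _ p₁ X₁ p₂ X₂ b hp hrule =>
    rw [← twoPoint_self, twoPoint_map, unprime_andS hrule]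
    refine exists_tr_of_twoPoint (BarRule.andT₁ p X _ _ _ _ _ hp hrule |>.tr_pure γ) ?_
    simp [unprime_primIf]
  | andT₂ p _ p₁ X₁ p₂ X₂ b hp hrule =>
    rw [twoPoint_map, unprime_andS hrule]
    refine exists_tr_of_twoPoint (BarRule.andT₂ p X _ _ _ _ _ hp hrule |>.tr_twoPoint γ) ?_
    simp [unprime_primIf]

lemma exists_tr_of_tr_unprime {s : BQ Q Γ × List Γ} {a : Act3} {d : PMF (BQ Q Γ × List Γ)}
    (h : (barPlts Q0 rule).Tr (unprime rule W s) a d) :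
    ∃ a' d', (barPlts Q0 rule).Tr s a' d' := by
  obtain ⟨q, _ | ⟨Y, γ⟩⟩ := s
  · obtain ⟨_, _, _, _, heq, -⟩ := h
    cases q <;> simp [unprime] at heq
  cases q with
  | base p | z => exact ⟨a, d, h⟩
  | prim p => exact exists_tr_primIf true p Y γ
  | orS p X b₁ b₂ =>
    cases hrule : rule p X with
    | dead | one => exact ⟨a, d, by simpa only [unprime, hrule] using h⟩
    | two p₁ X₁ p₂ X₂ =>
      rw [unprime_orS hrule] at h
      obtain ⟨_, _, _, e, heq, he, -⟩ := h
      simp only [Prod.mk.injEq, List.cons.injEq] at heq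
      obtain ⟨rfl, rfl, rfl⟩ := heq
      cases he with
      | orT _ _ _ _ _ _ _ _ hp =>
        exact ⟨_, _, BarRule.orT p Y _ _ _ _ b₁ b₂ hp hrule |>.tr_twoPoint γ⟩
  | andS p X i b =>
    cases hrule : rule p X with
    | dead | one => exact ⟨a, d, by simpa only [unprime, hrule] using h⟩
    | two p₁ X₁ p₂ X₂ =>
      rw [unprime_andS hrule] at h
      obtain ⟨_, _, _, e, heq, he, -⟩ := h
      simp only [Prod.mk.injEq, List.cons.injEq] at heq
      obtain ⟨rfl, rfl, rfl⟩ := heq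
      cases he with
      | andT₁ _ _ _ _ _ _ _ hp =>
        exact ⟨_, _, BarRule.andT₁ p Y _ _ _ _ b hp hrule |>.tr_pure γ⟩
      | andT₂ _ _ _ _ _ _ _ hp =>
        exact ⟨_, _, BarRule.andT₂ p Y _ _ _ _ b hp hrule |>.tr_twoPoint γ⟩

lemma IsWinningSet.isBisimulation (hW : IsWinningSet Q0 rule W) :
    (barPlts Q0 rule).IsBisimulation fun s t => unprime rule W s = unprime rule W t := by
  refine PLTS.isBisimulation_ker _ _ (fun s a d h => hW.tr_unprime h) fun s a d h => ?_
  obtain ⟨a', d', h'⟩ := exists_tr_of_tr_unprime h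
  obtain ⟨d'', h'', e⟩ := hW.tr_unprime h'
  obtain ⟨rfl, rfl⟩ := barPlts_det h h''
  exact ⟨d', h', e.symm⟩

lemma bisim_of_player0Wins {c₀ : Q × List Γ} (h : Player0Wins Q0 rule c₀) :
    (barPlts Q0 rule).Bisim (BQ.base c₀.1, c₀.2) (BQ.prim c₀.1, c₀.2) := by
  obtain ⟨W, hmem, hW⟩ := h
  refine ⟨_, IsWinningSet.isBisimulation hW, ?_⟩
  simp [unprime_base, unprime_prim, unprimeBit_of_mem hmem, primIf]

end Soundness

end BarSystem

/-- For a unary nondeterministic PDA (given by `rule`, with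
control-state partition `Q0` / its complement, every head dead or with at most
two successor configurations, and no empty-stack configuration reachable from
`p₀X₀`), and the fully probabilistic pvPDA `Δ̄` constructed from it:
`p₀X₀ ∼ p₀'X₀` in `S(Δ̄)` iff Player 0 wins the reachability game on `S(Δ)`
from `p₀X₀`. -/
theorem pda_game_reduction (Q Γ : Type) [Fintype Q] [Fintype Γ]
    (Q0 : Set Q) (rule : Q → Γ → RuleKind Q Γ) (p₀ : Q) (X₀ : Γ)
    (hlen : ∀ p X q α, rule p X = RuleKind.one q α → α.length ≤ 2)
    (hnoempty : ∀ p : Q, ¬ Relation.ReflTransGen (RSucc rule) (p₀, [X₀]) (p, [])) :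
    (PPDARules.plts (BarRule Q0 rule : PPDARules (BQ Q Γ) Γ Act3)).Bisim
        (BQ.base p₀, [X₀]) (BQ.prim p₀, [X₀])
      ↔ Player0Wins Q0 rule (p₀, [X₀]) := by
  exact ⟨player0Wins_of_bisim hnoempty, bisim_of_player0Wins⟩
end
end
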